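/- Fix an integer n ≥ 3, 0 < ρ < 1, and set δ = ((n-2)/n)ρ. Define H(t) := (2/(n²-1))(1-δ²t²)^{(n+1)/2} Σ_{k=2}^{∞} ((k-2)!/(n+2)_{k-2}) C_{k-2}^{(n+2)/2}(δt) C_k^{(n-2)/2}(t) ρ^k for t ∈ (-1,1). Then H is twice differentiable and H''(t) = 2δ²(1-δ²t²)^{(n-3)/2} Σ_{k=2}^{∞} (k!/(n-2)_k) C_k^{(n-2)/2}(δt) C_k^{(n-2)/2}(t) ρ^k − (4nδ²/(n-1))(1-δ²t²)^{(n-1)/2} Σ_{k=1}^{∞} (k!/(n)_k) C_k^{n/2}(δt) C_k^{n/2}(t) ρ^k + (2n³δ²/((n+1)(n-1)(n-2)))(1-δ²t²)^{(n+1)/2} Σ_{k=0}^{∞} (k!/(n+2)_k) C_k^{(n+2)/2}(δt) C_k^{(n+2)/2}(t) ρ^k. -/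

import Mathlib

open scoped Real BigOperators

/-- Pochhammer symbol `(lam)_m`. -/
noncomputable def poch (lam : ℝ) (m : ℕ) : ℝ := (ascPochhammer ℝ m).eval lam

/-- Gegenbauer polynomial `C_k^lam(x)`, via its explicit representation. -/
noncomputable def gegen (lam : ℝ) (k : ℕ) (x : ℝ) : ℝ :=
  ∑ j ∈ Finset.range (k / 2 + 1),
    (-1 : ℝ) ^ j * poch lam (k - j) / ((Nat.factorial j : ℝ) * (Nat.factorial (k - 2 * j) : ℝ))
      * (2 * x) ^ (k - 2 * j)

lemma poch_zero (l : ℝ) : poch l 0 = 1 := by simp [poch]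

lemma poch_succ (l : ℝ) (m : ℕ) : poch l (m + 1) = poch l m * (l + m) :=
  ascPochhammer_succ_eval m l

lemma poch_succ_left (l : ℝ) (m : ℕ) : poch l (m + 1) = l * poch (l + 1) m := by
  simp [poch, ascPochhammer_succ_left, Polynomial.eval_comp]

lemma poch_pos {l : ℝ} (hl : 0 < l) (m : ℕ) : 0 < poch l m := ascPochhammer_pos m l hl

/-- The coefficient of `(2x)^(k-2j)` in the Gegenbauer polynomial, extended by zero. -/
noncomputable def gegenCoeff (l : ℝ) (k j : ℕ) : ℝ :=
  if 2 * j ≤ k then (-1 : ℝ) ^ j * poch l (k - j) / ((j.factorial : ℝ) * ((k - 2 * j).factorial : ℝ))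
  else 0

lemma gegen_eq_sum (l : ℝ) {k N : ℕ} (hN : k / 2 < N) (x : ℝ) :
    gegen l k x = ∑ j ∈ Finset.range N, gegenCoeff l k j * (2 * x) ^ (k - 2 * j) := by
  rw [gegen]
  have hsub : Finset.range (k / 2 + 1) ⊆ Finset.range N :=
    Finset.range_subset_range.2 (by omega)
  rw [← Finset.sum_subset hsub]
  · refine Finset.sum_congr rfl fun j hj => ?_
    rw [Finset.mem_range] at hj
    rw [gegenCoeff, if_pos (by omega)]
  · intro j _ hj
    rw [Finset.mem_range] at hj
    rw [gegenCoeff, if_neg (by omega), zero_mul]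

lemma gegenCoeff_succ (l : ℝ) (k j : ℕ) :
    ((k + 1 : ℝ) - 2 * j) * gegenCoeff l (k + 1) j = l * gegenCoeff (l + 1) k j := by
  unfold gegenCoeff
  by_cases h : 2 * j ≤ k
  · obtain ⟨m, rfl⟩ := Nat.exists_eq_add_of_le h
    rw [if_pos (by omega), if_pos h, show 2 * j + m + 1 - j = (j + m) + 1 by omega,
      show 2 * j + m - j = j + m by omega, show 2 * j + m + 1 - 2 * j = m + 1 by omega,
      show 2 * j + m - 2 * j = m by omega, poch_succ_left, Nat.factorial_succ]
    push_cast
    field_simp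
    ring
  · rw [if_neg h]
    by_cases h' : 2 * j ≤ k + 1
    · have : (k + 1 : ℝ) = 2 * j := by exact_mod_cast (by omega : k + 1 = 2 * j)
      rw [this]; simp
    · rw [if_neg h']; simp

lemma gegenCoeff_succ_index (l : ℝ) (k j : ℕ) :
    (j + 1 : ℝ) * (l + k + 1 - j) * gegenCoeff l (k + 2) (j + 1)
      = -(l * (l + 1) * gegenCoeff (l + 2) k j) := by
  unfold gegenCoeff
  by_cases h : 2 * j ≤ k
  · obtain ⟨m, rfl⟩ := Nat.exists_eq_add_of_le h
    have h1 := poch_succ l (j + m + 1)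
    rw [poch_succ_left, poch_succ_left, show l + 1 + 1 = l + 2 by ring] at h1
    rw [if_pos (by omega), if_pos h, show 2 * j + m + 2 - (j + 1) = j + m + 1 by omega,
      show 2 * j + m - j = j + m by omega, show 2 * j + m + 2 - 2 * (j + 1) = m by omega,
      show 2 * j + m - 2 * j = m by omega, Nat.factorial_succ]
    push_cast at h1 ⊢
    field_simp
    linear_combination (-(-1 : ℝ) ^ j) * (-h1)
  · rw [if_neg h, if_neg (by omega)]; simp

lemma gegen_zero (l x : ℝ) : gegen l 0 x = 1 := by simp [gegen, poch_zero]

lemma gegen_one (l x : ℝ) : gegen l 1 x = 2 * l * x := by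
  simp [gegen, poch_succ, poch_zero]; ring

lemma gegen_neg (l : ℝ) (k : ℕ) (x : ℝ) : gegen l k (-x) = (-1) ^ k * gegen l k x := by
  rw [gegen, gegen, Finset.mul_sum]
  refine Finset.sum_congr rfl fun j hj => ?_
  rw [Finset.mem_range] at hj
  obtain ⟨m, rfl⟩ := Nat.exists_eq_add_of_le (show 2 * j ≤ k by omega)
  rw [show 2 * j + m - 2 * j = m by omega, mul_neg, neg_pow (2 * x), pow_add, pow_mul]
  simp; ring

lemma hasDerivAt_gegen_succ (l : ℝ) (k : ℕ) (x : ℝ) :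
    HasDerivAt (gegen l (k + 1)) (2 * l * gegen (l + 1) k x) x := by
  have hN : (k + 1) / 2 < k + 2 := by omega
  have hfun : gegen l (k + 1) = fun x => ∑ j ∈ Finset.range (k + 2),
      gegenCoeff l (k + 1) j * (2 * x) ^ (k + 1 - 2 * j) :=
    funext fun x => gegen_eq_sum l hN x
  rw [hfun, gegen_eq_sum (l + 1) (show k / 2 < k + 2 by omega), Finset.mul_sum]
  refine HasDerivAt.fun_sum fun j _ => ?_
  have h := ((((hasDerivAt_id x).const_mul 2).pow (k + 1 - 2 * j)).const_mul
    (gegenCoeff l (k + 1) j))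
  refine h.congr_deriv ?_
  have hc := gegenCoeff_succ l k j
  by_cases h2 : 2 * j ≤ k
  · obtain ⟨m, rfl⟩ := Nat.exists_eq_add_of_le h2
    rw [show 2 * j + m + 1 - 2 * j = m + 1 by omega, show 2 * j + m - 2 * j = m by omega]
    push_cast at hc ⊢
    simp only [id]
    linear_combination (2 * (2 * x) ^ m) * hc
  · rw [show k + 1 - 2 * j = 0 by omega, gegenCoeff.eq_1 (l + 1), if_neg h2]; simp

lemma gegen_ode_aux (l : ℝ) (k : ℕ) (x : ℝ) :
    ((k : ℝ) + 2) * (k + 2 + 2 * l) * gegen l (k + 2) x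
      = (2 * l + 1) * x * (2 * l * gegen (l + 1) (k + 1) x)
        - (1 - x ^ 2) * (4 * l * (l + 1) * gegen (l + 2) k x) := by
  have h1 : x * (2 * l * gegen (l + 1) (k + 1) x) = ∑ j ∈ Finset.range (k + 3),
      ((k + 2 : ℝ) - 2 * j) * gegenCoeff l (k + 2) j * (2 * x) ^ (k + 2 - 2 * j) := by
    rw [gegen_eq_sum (l + 1) (show (k + 1) / 2 < k + 3 by omega), Finset.mul_sum, Finset.mul_sum]
    refine Finset.sum_congr rfl fun j _ => ?_
    have hc := gegenCoeff_succ l (k + 1) j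
    push_cast at hc
    rw [show (k : ℝ) + 2 = k + 1 + 1 by ring, hc]
    by_cases h2 : 2 * j ≤ k + 1
    · obtain ⟨m, hm⟩ := Nat.exists_eq_add_of_le h2
      rw [show k + 2 - 2 * j = m + 1 by omega, show k + 1 - 2 * j = m by omega]
      ring
    · rw [gegenCoeff, if_neg h2]; simp
  have h2 : x ^ 2 * (4 * l * (l + 1) * gegen (l + 2) k x) = ∑ j ∈ Finset.range (k + 3),
      ((k + 2 : ℝ) - 2 * j) * (k + 1 - 2 * j) * gegenCoeff l (k + 2) j
        * (2 * x) ^ (k + 2 - 2 * j) := by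
    rw [gegen_eq_sum (l + 2) (show k / 2 < k + 3 by omega), Finset.mul_sum, Finset.mul_sum]
    refine Finset.sum_congr rfl fun j _ => ?_
    have hc := gegenCoeff_succ l (k + 1) j
    have hc' := gegenCoeff_succ (l + 1) k j
    rw [show l + 1 + 1 = l + 2 by ring] at hc'
    push_cast at hc
    have : ((k + 2 : ℝ) - 2 * j) * (k + 1 - 2 * j) * gegenCoeff l (k + 2) j
        = l * (l + 1) * gegenCoeff (l + 2) k j := by
      linear_combination (k + 1 - 2 * j : ℝ) * hc + l * hc'
    rw [this]
    by_cases h2 : 2 * j ≤ k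
    · obtain ⟨m, hm⟩ := Nat.exists_eq_add_of_le h2
      rw [show k + 2 - 2 * j = m + 2 by omega, show k - 2 * j = m by omega]
      ring
    · rw [gegenCoeff, if_neg h2]; simp
  have h3 : 4 * l * (l + 1) * gegen (l + 2) k x = -∑ j ∈ Finset.range (k + 3),
      4 * (j : ℝ) * (l + k + 2 - j) * gegenCoeff l (k + 2) j * (2 * x) ^ (k + 2 - 2 * j) := by
    rw [Finset.sum_range_succ', gegen_eq_sum (l + 2) (show k / 2 < k + 2 by omega),
      Finset.mul_sum]
    simp only [Nat.cast_zero, mul_zero, zero_mul, add_zero]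
    rw [← Finset.sum_neg_distrib]
    refine Finset.sum_congr rfl fun j _ => ?_
    have hc := gegenCoeff_succ_index l k j
    rw [show k + 2 - 2 * (j + 1) = k - 2 * j by omega]
    push_cast
    linear_combination (4 * (2 * x) ^ (k - 2 * j)) * hc
  have h4 : ((k : ℝ) + 2) * (k + 2 + 2 * l) * gegen l (k + 2) x
      = (2 * l + 1) * (x * (2 * l * gegen (l + 1) (k + 1) x))
        + x ^ 2 * (4 * l * (l + 1) * gegen (l + 2) k x)
        - 4 * l * (l + 1) * gegen (l + 2) k x := by
    rw [h2, h1, h3, gegen_eq_sum l (show (k + 2) / 2 < k + 3 by omega), sub_neg_eq_add,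
      Finset.mul_sum, Finset.mul_sum, ← Finset.sum_add_distrib, ← Finset.sum_add_distrib]
    refine Finset.sum_congr rfl fun j _ => ?_
    ring
  linear_combination h4

/-- The Gegenbauer differential equation, in terms of the derivative of `C_k^(l+1)`. -/
lemma gegen_hasDerivAt_ode (l : ℝ) (k : ℕ) (x : ℝ) :
    ∃ d, HasDerivAt (gegen (l + 1) k) d x ∧
      ((k : ℝ) + 1) * (k + 1 + 2 * l) * gegen l (k + 1) x
        = 2 * l * ((2 * l + 1) * x * gegen (l + 1) k x - (1 - x ^ 2) * d) := by
  cases k with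
  | zero =>
    refine ⟨0, ?_, ?_⟩
    · rw [show gegen (l + 1) 0 = fun _ => 1 from funext (gegen_zero _)]
      exact hasDerivAt_const _ _
    · rw [gegen_zero, zero_add, gegen_one]; push_cast; ring
  | succ k =>
    refine ⟨_, hasDerivAt_gegen_succ (l + 1) k x, ?_⟩
    have h := gegen_ode_aux l k x
    rw [show l + 1 + 1 = l + 2 by ring]
    push_cast
    linear_combination h

lemma gegen_at_one {l : ℝ} (hl : 0 < l) (k : ℕ) :
    gegen l k 1 = poch (2 * l) k / k.factorial := by
  induction k generalizing l with
  | zero => simp [gegen_zero, poch_zero]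
  | succ k ih =>
    obtain ⟨d, _, h⟩ := gegen_hasDerivAt_ode l k 1
    rw [ih (by linarith : 0 < l + 1)] at h
    have h1 := poch_succ (2 * l) (k + 1)
    rw [poch_succ_left, poch_succ_left, show 2 * l + 1 + 1 = 2 * (l + 1) by ring] at h1
    have hp : (0 : ℝ) < k + 1 + 2 * l := by positivity
    rw [eq_div_iff (by positivity), Nat.factorial_succ]
    push_cast at h1 ⊢
    have hk : (k.factorial : ℝ) ≠ 0 := by positivity
    field_simp at h
    refine mul_right_cancel₀ hp.ne' ?_
    linear_combination h + h1

lemma abs_gegen_le_of_nonneg {l : ℝ} (hl : 0 < l) (k : ℕ) {x : ℝ} (hx : 0 ≤ x) (hx1 : x ≤ 1) :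
    |gegen l k x| ≤ |gegen l k 1| := by
  cases k with
  | zero => simp [gegen_zero]
  | succ k =>
    set c : ℝ := ((k : ℝ) + 1) * (k + 1 + 2 * l) with hc
    have hc0 : 0 < c := by positivity
    have hderiv : ∀ t : ℝ, HasDerivAt
        (fun s => c * gegen l (k + 1) s ^ 2 + (1 - s ^ 2) * (2 * l * gegen (l + 1) k s) ^ 2)
        (4 * l * t * (2 * l * gegen (l + 1) k t) ^ 2) t := by
      intro t
      obtain ⟨d, hd, ho⟩ := gegen_hasDerivAt_ode l k t
      have h1 := ((hasDerivAt_gegen_succ l k t).pow 2).const_mul c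
      have h2 := (((hasDerivAt_id t).pow 2).const_sub 1).mul ((hd.const_mul (2 * l)).pow 2)
      refine (h1.add h2).congr_deriv ?_
      simp only [id, Nat.cast_ofNat, Nat.add_one_sub_one, pow_one, Pi.pow_apply]
      rw [← hc] at ho
      linear_combination (4 * l * gegen (l + 1) k t) * ho
    have hmono : MonotoneOn
        (fun s => c * gegen l (k + 1) s ^ 2 + (1 - s ^ 2) * (2 * l * gegen (l + 1) k s) ^ 2)
        (Set.Icc 0 1) := by
      refine monotoneOn_of_deriv_nonneg (convex_Icc 0 1)
        (fun t _ => (hderiv t).continuousAt.continuousWithinAt)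
        (fun t _ => (hderiv t).differentiableAt.differentiableWithinAt) fun t ht => ?_
      rw [interior_Icc] at ht
      rw [(hderiv t).deriv]
      have := ht.1
      positivity
    have h := hmono ⟨hx, hx1⟩ (Set.right_mem_Icc.2 zero_le_one) hx1
    simp only [one_pow, sub_self, zero_mul, add_zero] at h
    have hnn : 0 ≤ (1 - x ^ 2) * (2 * l * gegen (l + 1) k x) ^ 2 :=
      mul_nonneg (by nlinarith) (sq_nonneg _)
    exact sq_le_sq.1 (le_of_mul_le_mul_left (by linarith) hc0)

lemma abs_gegen_le {l : ℝ} (hl : 0 < l) (k : ℕ) {x : ℝ} (hx : |x| ≤ 1) :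
    |gegen l k x| ≤ poch (2 * l) k / k.factorial := by
  have h1 : |gegen l k 1| = poch (2 * l) k / k.factorial := by
    rw [gegen_at_one hl, abs_of_nonneg]
    have := poch_pos (by linarith : 0 < 2 * l) k
    positivity
  rw [← h1]
  rcases le_total 0 x with h | h
  · exact abs_gegen_le_of_nonneg hl k h (le_of_abs_le hx)
  · have := abs_gegen_le_of_nonneg hl k (neg_nonneg.2 h) (by linarith [neg_le_of_abs_le hx])
    rwa [gegen_neg, abs_mul, abs_pow, abs_neg, abs_one, one_pow, one_mul] at this

lemma summable_poch_div_factorial (N : ℕ) {r : ℝ} (hr0 : 0 ≤ r) (hr : r < 1) :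
    Summable fun k : ℕ => poch ((N : ℝ) + 1) k / k.factorial * r ^ k := by
  have h := summable_choose_mul_geometric_of_norm_lt_one (R := ℝ) N
    (r := r) (by rwa [Real.norm_of_nonneg hr0])
  refine h.congr fun k => ?_
  congr 1
  rw [eq_div_iff (by positivity), poch]
  have h1 : (ascPochhammer ℝ k).eval ((N : ℝ) + 1) = ((N + 1).ascFactorial k : ℝ) := by
    rw [← ascPochhammer_nat_eq_ascFactorial, ascPochhammer_eval_cast]; push_cast; rfl
  rw [h1, Nat.ascFactorial_eq_factorial_mul_choose, add_comm N k, ← Nat.choose_symm_add]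
  push_cast; ring

/-- The weighted normalized Gegenbauer function `(1-x²)^(l-1/2) C_k^l(x)/C_k^l(1)` at `x = δ t`. -/
noncomputable def weightedGegen (δ l : ℝ) (k : ℕ) (t : ℝ) : ℝ :=
  (1 - δ ^ 2 * t ^ 2) ^ (l - 1 / 2) * (k.factorial / poch (2 * l) k * gegen l k (δ * t))

lemma one_sub_pos_of_mem {δ t : ℝ} (hδ : |δ| < 1) (ht : t ∈ Set.Ioo (-1 : ℝ) 1) :
    0 < 1 - δ ^ 2 * t ^ 2 := by
  have h1 : δ ^ 2 < 1 := by rwa [sq_lt_one_iff_abs_lt_one]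
  have h2 : t ^ 2 < 1 := by rw [sq_lt_one_iff_abs_lt_one, abs_lt]; exact ht
  nlinarith [sq_nonneg δ, sq_nonneg t]

lemma abs_weightedGegen_le {δ l t : ℝ} (hδ : |δ| < 1) (hl : 1 / 2 ≤ l) (k : ℕ)
    (ht : t ∈ Set.Ioo (-1 : ℝ) 1) : |weightedGegen δ l k t| ≤ 1 := by
  have hb := one_sub_pos_of_mem hδ ht
  have hp := poch_pos (by linarith : 0 < 2 * l) k
  have hx : |δ * t| ≤ 1 := by
    rw [abs_mul]
    exact mul_le_one₀ hδ.le (abs_nonneg _) (abs_lt.2 ht).le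
  have hg := abs_gegen_le (by linarith : 0 < l) k hx
  rw [weightedGegen, abs_mul, abs_mul, abs_of_nonneg (Real.rpow_nonneg hb.le _),
    abs_of_nonneg (by positivity : (0 : ℝ) ≤ k.factorial / poch (2 * l) k)]
  refine mul_le_one₀ (Real.rpow_le_one hb.le (by nlinarith [sq_nonneg (δ * t)]) (by linarith))
    (by positivity) ?_
  calc _ ≤ k.factorial / poch (2 * l) k * (poch (2 * l) k / k.factorial) := by gcongr
    _ = 1 := by field_simp

lemma hasDerivAt_weightedGegen {δ l t : ℝ} (hδ : |δ| < 1) (hl : 0 < l) (k : ℕ)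
    (ht : t ∈ Set.Ioo (-1 : ℝ) 1) :
    HasDerivAt (weightedGegen δ (l + 1) k)
      (-(2 * l + 1) * δ * weightedGegen δ l (k + 1) t) t := by
  have hb := one_sub_pos_of_mem hδ ht
  obtain ⟨d, hd, ho⟩ := gegen_hasDerivAt_ode l k (δ * t)
  have hlin : HasDerivAt (fun s => δ * s) δ t := by
    simpa using (hasDerivAt_id t).const_mul δ
  have h1 := (hd.comp t hlin).const_mul (k.factorial / poch (2 * (l + 1)) k)
  have h2 : HasDerivAt (fun s => 1 - δ ^ 2 * s ^ 2) (-(δ ^ 2 * (2 * t))) t := by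
    simpa using ((hasDerivAt_pow 2 t).const_mul (δ ^ 2)).const_sub 1
  have h3 := h2.rpow_const (p := l + 1 - 1 / 2) (Or.inl hb.ne')
  refine (h3.mul h1).congr_deriv ?_
  have hw : (1 - δ ^ 2 * t ^ 2) ^ (l + 1 - 1 / 2)
      = (1 - δ ^ 2 * t ^ 2) ^ (l - 1 / 2) * (1 - δ ^ 2 * t ^ 2) := by
    rw [← Real.rpow_add_one hb.ne']; ring_nf
  rw [weightedGegen, hw, show l + 1 - 1 / 2 - 1 = l - 1 / 2 by ring]
  have hp : 0 < poch (2 * (l + 1)) k := poch_pos (by linarith) k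
  have hq : 0 < poch (2 * l) (k + 1) := poch_pos (by linarith) _
  have hpq := poch_succ (2 * l) (k + 1)
  rw [poch_succ_left, poch_succ_left, show 2 * l + 1 + 1 = 2 * (l + 1) by ring] at hpq
  have hs : (0 : ℝ) < k + 1 + 2 * l := by positivity
  have hg : gegen l (k + 1) (δ * t) = 2 * l * ((2 * l + 1) * (δ * t) * gegen (l + 1) k (δ * t)
      - (1 - (δ * t) ^ 2) * d) / ((k + 1) * (k + 1 + 2 * l)) := by
    rw [eq_div_iff (by positivity)]; linear_combination ho
  have hP : poch (2 * l) (k + 1)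
      = 2 * l * ((2 * l + 1) * poch (2 * (l + 1)) k) / (k + 1 + 2 * l) := by
    rw [eq_div_iff hs.ne']; push_cast at hpq; linear_combination -hpq
  rw [hg, hP, Nat.factorial_succ]
  push_cast
  simp only [Function.comp]
  field_simp
  ring

lemma abs_gegen_mul_pow_le {l ρ t : ℝ} (hl : 0 < l) (hρ : 0 ≤ ρ) (k : ℕ)
    (ht : t ∈ Set.Ioo (-1 : ℝ) 1) :
    |gegen l k t * ρ ^ k| ≤ poch (2 * l) k / k.factorial * ρ ^ k := by
  rw [abs_mul, abs_of_nonneg (pow_nonneg hρ k)]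
  gcongr
  exact abs_gegen_le hl k (abs_lt.2 ht).le

lemma hasDerivAt_gegen_mul_pow (l ρ : ℝ) (k : ℕ) (t : ℝ) :
    HasDerivAt (fun s => gegen l (k + 1) s * ρ ^ (k + 1))
      (2 * l * ρ * (gegen (l + 1) k t * ρ ^ k)) t :=
  ((hasDerivAt_gegen_succ l k t).mul_const _).congr_deriv (by ring)

lemma hasDerivAt_tsum_mul {f f' g g' : ℕ → ℝ → ℝ} {s : Set ℝ} {u v : ℕ → ℝ} {M M' : ℝ}
    (hs : IsOpen s) (hs' : IsPreconnected s) (hu : Summable u) (hv : Summable v)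
    (hf : ∀ k, ∀ t ∈ s, HasDerivAt (f k) (f' k t) t)
    (hg : ∀ k, ∀ t ∈ s, HasDerivAt (g k) (g' k t) t)
    (bf : ∀ k, ∀ t ∈ s, |f k t| ≤ M) (bf' : ∀ k, ∀ t ∈ s, |f' k t| ≤ M')
    (bg : ∀ k, ∀ t ∈ s, |g k t| ≤ u k) (bg' : ∀ k, ∀ t ∈ s, |g' k t| ≤ v k)
    {t : ℝ} (ht : t ∈ s) :
    HasDerivAt (fun t => ∑' k, f k t * g k t)
      ((∑' k, f' k t * g k t) + ∑' k, f k t * g' k t) t := by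
  have key : ∀ {a b A B : ℝ}, |a| ≤ A → |b| ≤ B → ‖a * b‖ ≤ A * B := fun ha hb => by
    rw [Real.norm_eq_abs, abs_mul]
    exact mul_le_mul ha hb (abs_nonneg _) ((abs_nonneg _).trans ha)
  have s1 : Summable fun k => f' k t * g k t :=
    Summable.of_norm_bounded (hu.mul_left M') fun k => key (bf' k t ht) (bg k t ht)
  have s2 : Summable fun k => f k t * g' k t :=
    Summable.of_norm_bounded (hv.mul_left M) fun k => key (bf k t ht) (bg' k t ht)
  rw [← s1.tsum_add s2]
  refine hasDerivAt_tsum_of_isPreconnected ((hu.mul_left M').add (hv.mul_left M)) hs hs'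
    (fun k y hy => (hf k y hy).mul (hg k y hy)) (fun k y hy => ?_) ht
    (Summable.of_norm_bounded (hu.mul_left M) fun k => key (bf k t ht) (bg k t ht)) ht
  exact (norm_add_le _ _).trans
    (add_le_add (key (bf' k y hy) (bg k y hy)) (key (bf k y hy) (bg' k y hy)))

/-- The bilinear Gegenbauer series with weight in its first factor. -/
noncomputable def gegenSeries (δ ρ l : ℝ) (a : ℕ) (m : ℝ) (b : ℕ) (t : ℝ) : ℝ :=
  ∑' k : ℕ, weightedGegen δ l (k + a) t * (gegen m (k + b) t * ρ ^ (k + b))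

lemma hasDerivAt_gegenSeries {δ ρ l m t : ℝ} (hδ : |δ| < 1) (hρ : 0 ≤ ρ) (hρ' : ρ < 1)
    (hl : 1 / 2 ≤ l) (N : ℕ) (hm : 2 * m = N + 1) (a b : ℕ) (ht : t ∈ Set.Ioo (-1 : ℝ) 1) :
    HasDerivAt (gegenSeries δ ρ (l + 1) a m (b + 1))
      (-(2 * l + 1) * δ * gegenSeries δ ρ l (a + 1) m (b + 1) t
        + 2 * m * ρ * gegenSeries δ ρ (l + 1) a (m + 1) b t) t := by
  have hm0 : 0 < m := by
    have : (0 : ℝ) < N + 1 := by positivity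
    linarith
  have su : Summable fun k : ℕ =>
      poch (2 * m) (k + (b + 1)) / (k + (b + 1)).factorial * ρ ^ (k + (b + 1)) := by
    rw [hm]
    exact (summable_nat_add_iff
      (f := fun k : ℕ => poch ((N : ℝ) + 1) k / k.factorial * ρ ^ k) (b + 1)).2 (summable_poch_div_factorial N hρ hρ')
  have sv : Summable fun k : ℕ => |2 * m * ρ| *
      (poch (2 * (m + 1)) (k + b) / (k + b).factorial * ρ ^ (k + b)) := by
    rw [show 2 * (m + 1) = ((N + 2 : ℕ) : ℝ) + 1 by push_cast; linarith]
    exact ((summable_nat_add_iff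
      (f := fun k : ℕ => poch (((N + 2 : ℕ) : ℝ) + 1) k / k.factorial * ρ ^ k) b).2
        (summable_poch_div_factorial (N + 2) hρ hρ')).mul_left _
  have hf : ∀ k : ℕ, ∀ t ∈ Set.Ioo (-1 : ℝ) 1, HasDerivAt (weightedGegen δ (l + 1) (k + a))
      (-(2 * l + 1) * δ * weightedGegen δ l (k + (a + 1)) t) t := fun k t ht => by
    rw [← add_assoc]
    exact hasDerivAt_weightedGegen hδ (by linarith) _ ht
  have hg : ∀ k : ℕ, ∀ t ∈ Set.Ioo (-1 : ℝ) 1,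
      HasDerivAt (fun t => gegen m (k + (b + 1)) t * ρ ^ (k + (b + 1)))
      (2 * m * ρ * (gegen (m + 1) (k + b) t * ρ ^ (k + b))) t := fun k t _ => by
    rw [← add_assoc]
    exact hasDerivAt_gegen_mul_pow m ρ _ t
  have bf : ∀ k : ℕ, ∀ t ∈ Set.Ioo (-1 : ℝ) 1, |weightedGegen δ (l + 1) (k + a) t| ≤ 1 :=
    fun k t ht => abs_weightedGegen_le hδ (by linarith) _ ht
  have bf' : ∀ k : ℕ, ∀ t ∈ Set.Ioo (-1 : ℝ) 1,
      |-(2 * l + 1) * δ * weightedGegen δ l (k + (a + 1)) t| ≤ |-(2 * l + 1) * δ| * 1 :=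
    fun k t ht => by
      rw [abs_mul]
      exact mul_le_mul_of_nonneg_left (abs_weightedGegen_le hδ hl _ ht) (abs_nonneg _)
  have bg : ∀ k : ℕ, ∀ t ∈ Set.Ioo (-1 : ℝ) 1, |gegen m (k + (b + 1)) t * ρ ^ (k + (b + 1))|
      ≤ poch (2 * m) (k + (b + 1)) / (k + (b + 1)).factorial * ρ ^ (k + (b + 1)) :=
    fun k t ht => abs_gegen_mul_pow_le hm0 hρ _ ht
  have bg' : ∀ k : ℕ, ∀ t ∈ Set.Ioo (-1 : ℝ) 1,
      |2 * m * ρ * (gegen (m + 1) (k + b) t * ρ ^ (k + b))|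
      ≤ |2 * m * ρ| * (poch (2 * (m + 1)) (k + b) / (k + b).factorial * ρ ^ (k + b)) :=
    fun k t ht => by
      rw [abs_mul]
      exact mul_le_mul_of_nonneg_left
        (abs_gegen_mul_pow_le (by linarith) hρ _ ht) (abs_nonneg _)
  refine (hasDerivAt_tsum_mul isOpen_Ioo isPreconnected_Ioo su sv hf hg bf bf' bg bg'
    ht).congr_deriv ?_
  rw [gegenSeries, gegenSeries, ← tsum_mul_left, ← tsum_mul_left]
  congr 1 <;> exact tsum_congr fun k => by ring

lemma gegenSeries_eq (δ ρ l : ℝ) (a : ℕ) (m : ℝ) (b : ℕ) (t : ℝ) :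
    gegenSeries δ ρ l a m b t = (1 - δ ^ 2 * t ^ 2) ^ (l - 1 / 2) *
      ∑' k : ℕ, ((k + a).factorial : ℝ) / poch (2 * l) (k + a) * gegen l (k + a) (δ * t)
        * gegen m (k + b) t * ρ ^ (k + b) := by
  rw [gegenSeries, ← tsum_mul_left]
  exact tsum_congr fun k => by rw [weightedGegen]; ring

theorem second_derivative_of_H (n : ℕ) (hn : 3 ≤ n) (ρ δ : ℝ)
    (hρ : 0 < ρ) (hρ' : ρ < 1) (hδ : δ = ((n:ℝ) - 2)/(n:ℝ) * ρ)
    (H : ℝ → ℝ)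
    (hH : ∀ t : ℝ, H t = 2/((n:ℝ)^2 - 1) * (1 - δ^2*t^2) ^ (((n:ℝ) + 1)/2)
        * ∑' k : ℕ, (Nat.factorial k : ℝ) / poch ((n:ℝ) + 2) k
            * gegen (((n:ℝ) + 2)/2) k (δ*t) * gegen (((n:ℝ) - 2)/2) (k + 2) t * ρ^(k + 2)) :
    (∀ t ∈ Set.Ioo (-1:ℝ) 1, DifferentiableAt ℝ H t ∧ DifferentiableAt ℝ (deriv H) t) ∧
    ∀ t ∈ Set.Ioo (-1:ℝ) 1,
      deriv (deriv H) t
        = 2*δ^2*(1 - δ^2*t^2) ^ (((n:ℝ) - 3)/2)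
            * ∑' k : ℕ, (Nat.factorial (k + 2) : ℝ) / poch ((n:ℝ) - 2) (k + 2)
                * gegen (((n:ℝ) - 2)/2) (k + 2) (δ*t) * gegen (((n:ℝ) - 2)/2) (k + 2) t
                * ρ^(k + 2)
          - 4*(n:ℝ)*δ^2/((n:ℝ) - 1) * (1 - δ^2*t^2) ^ (((n:ℝ) - 1)/2)
            * ∑' k : ℕ, (Nat.factorial (k + 1) : ℝ) / poch (n:ℝ) (k + 1)
                * gegen ((n:ℝ)/2) (k + 1) (δ*t) * gegen ((n:ℝ)/2) (k + 1) t * ρ^(k + 1)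
          + 2*(n:ℝ)^3*δ^2/(((n:ℝ) + 1)*((n:ℝ) - 1)*((n:ℝ) - 2))
            * (1 - δ^2*t^2) ^ (((n:ℝ) + 1)/2)
            * ∑' k : ℕ, (Nat.factorial k : ℝ) / poch ((n:ℝ) + 2) k
                * gegen (((n:ℝ) + 2)/2) k (δ*t) * gegen (((n:ℝ) + 2)/2) k t * ρ^k := by
  have hn3 : (3 : ℝ) ≤ n := by exact_mod_cast hn
  obtain ⟨N, rfl⟩ := Nat.exists_eq_add_of_le' hn
  set n' : ℝ := ((N + 3 : ℕ) : ℝ) with hn'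
  have hN : n' = N + 3 := by rw [hn']; push_cast; ring
  have hn0 : n' ≠ 0 := by linarith
  have hδ1 : |δ| < 1 := by
    have h1 : 0 ≤ (n' - 2) / n' := div_nonneg (by linarith) (by linarith)
    have h2 : (n' - 2) / n' ≤ 1 := (div_le_one (by linarith)).2 (by linarith)
    rw [hδ, abs_of_nonneg (by positivity)]
    nlinarith
  have hρδ : ρ = n' / (n' - 2) * δ := by
    have : n' - 2 ≠ 0 := by linarith
    rw [hδ]; field_simp
  set ν : ℝ := (n' - 2) / 2 with hν
  have hν1 : 1 / 2 ≤ ν := by rw [hν]; linarith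
  have hH' : H = fun t => 2 / (n' ^ 2 - 1) * gegenSeries δ ρ (ν + 1 + 1) 0 ν 2 t := by
    funext t
    rw [hH, gegenSeries_eq, show ν + 1 + 1 - 1 / 2 = (n' + 1) / 2 by rw [hν]; ring,
      show ν + 1 + 1 = (n' + 2) / 2 by rw [hν]; ring, show 2 * ((n' + 2) / 2) = n' + 2 by ring]
    simp only [add_zero]
    ring
  have d0 : ∀ t ∈ Set.Ioo (-1 : ℝ) 1, HasDerivAt H (2 / (n' ^ 2 - 1) *
      (-(2 * (ν + 1) + 1) * δ * gegenSeries δ ρ (ν + 1) 1 ν 2 t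
        + 2 * ν * ρ * gegenSeries δ ρ (ν + 1 + 1) 0 (ν + 1) 1 t)) t := fun t ht => by
    rw [hH']
    exact (hasDerivAt_gegenSeries hδ1 hρ.le hρ' (by linarith) N (by rw [hν]; linarith) 0 1
      ht).const_mul _
  have d1 : ∀ t ∈ Set.Ioo (-1 : ℝ) 1, HasDerivAt (deriv H) (2 / (n' ^ 2 - 1) *
      (-(2 * (ν + 1) + 1) * δ * (-(2 * ν + 1) * δ * gegenSeries δ ρ ν 2 ν 2 t
          + 2 * ν * ρ * gegenSeries δ ρ (ν + 1) 1 (ν + 1) 1 t)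
        + 2 * ν * ρ * (-(2 * (ν + 1) + 1) * δ * gegenSeries δ ρ (ν + 1) 1 (ν + 1) 1 t
          + 2 * (ν + 1) * ρ * gegenSeries δ ρ (ν + 1 + 1) 0 (ν + 1 + 1) 0 t))) t := fun t ht => by
    have h1 := hasDerivAt_gegenSeries (δ := δ) (m := ν) hδ1 hρ.le hρ' hν1 N
      (by rw [hν]; linarith) 1 1 ht
    have h2 := hasDerivAt_gegenSeries (δ := δ) (l := ν + 1) (m := ν + 1) hδ1 hρ.le hρ'
      (by linarith) (N + 2) (by rw [hν]; push_cast; linarith) 0 0 ht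
    refine (((h1.const_mul _).add (h2.const_mul _)).const_mul _).congr_of_eventuallyEq ?_
    filter_upwards [isOpen_Ioo.mem_nhds ht] with s hs
    exact (d0 s hs).deriv
  refine ⟨fun t ht => ⟨(d0 t ht).differentiableAt, (d1 t ht).differentiableAt⟩, fun t ht => ?_⟩
  rw [(d1 t ht).deriv]
  simp only [gegenSeries_eq]
  rw [show ν + 1 + 1 - 1 / 2 = (n' + 1) / 2 by rw [hν]; ring,
    show ν + 1 - 1 / 2 = (n' - 1) / 2 by rw [hν]; ring,
    show ν - 1 / 2 = (n' - 3) / 2 by rw [hν]; ring,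
    show 2 * (ν + 1 + 1) = n' + 2 by rw [hν]; ring,
    show 2 * (ν + 1) = n' by rw [hν]; ring,
    show ν + 1 + 1 = (n' + 2) / 2 by rw [hν]; ring,
    show ν + 1 = n' / 2 by rw [hν]; ring,
    show 2 * ν = n' - 2 by rw [hν]; ring]
  simp only [add_zero]
  generalize (∑' k : ℕ, ((k + 2).factorial : ℝ) / poch (n' - 2) (k + 2)
    * gegen ν (k + 2) (δ * t) * gegen ν (k + 2) t * ρ ^ (k + 2)) = S₂
  generalize (∑' k : ℕ, ((k + 1).factorial : ℝ) / poch n' (k + 1)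
    * gegen (n' / 2) (k + 1) (δ * t) * gegen (n' / 2) (k + 1) t * ρ ^ (k + 1)) = S₁
  generalize (∑' k : ℕ, (k.factorial : ℝ) / poch (n' + 2) k
    * gegen ((n' + 2) / 2) k (δ * t) * gegen ((n' + 2) / 2) k t * ρ ^ k) = S₀
  have e1 : n' - 2 ≠ 0 := by linarith
  have e2 : n' - 1 ≠ 0 := by linarith
  have e3 : n' + 1 ≠ 0 := by linarith
  rw [show n' ^ 2 - 1 = (n' + 1) * (n' - 1) by ring, hρδ]
  clear_value ν n'
  field_simp
  ring
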